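/- Comparison principle: Suppose Hamiltonians H₁ and H₂ satisfy conditions (A.1)–(A.5) and σ : C → ℝ satisfies (A.6). Let φ₁ be a lower solution of the Cauchy problem with Hamiltonian H₁, let φ₂ be an upper solution of the Cauchy problem with Hamiltonian H₂ (both with boundary functional σ), and fix (t,x(·)) ∈ [0,T) × C. Suppose that for every y(·) ∈ Y(t,x(·);c_{H₁}(·)) there exists a set E = E(y(·)) ⊂ [t,T] with μ(E) = T − t such that H₁(τ,y(·),s) ≤ H₂(τ,y(·),s) for all τ ∈ E and s ∈ ℝⁿ. Then φ₁(t,x(·)) ≤ φ₂(t,x(·)). -/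

import Mathlib

open MeasureTheory Set Filter Topology

noncomputable section

attribute [local instance] Classical.propDecidable

/-- Euclidean space `ℝⁿ`. -/
abbrev Euc (n : ℕ) : Type := EuclideanSpace ℝ (Fin n)

/-- The path space `C([-h,T], ℝⁿ)` with the sup norm. -/
abbrev PathSp (n : ℕ) (h T : ℝ) : Type := ContinuousMap (Set.Icc (-h) T) (Euc n)

/-- The time map `τ ↦ τ ∧ t` on `[-h,T]` (for `t ∈ [0,T]`, `h ≥ 0`, this is `min τ t`). -/
def stopTime (h T t : ℝ) (τ : Set.Icc (-h) T) : Set.Icc (-h) T :=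
  ⟨max (-h) (min τ.1 t), le_max_left _ _,
    max_le (le_trans τ.2.1 τ.2.2) (le_trans (min_le_left _ _) τ.2.2)⟩

lemma continuous_stopTime (h T t : ℝ) : Continuous (stopTime h T t) :=
  Continuous.subtype_mk
    (continuous_const.max (continuous_subtype_val.min continuous_const)) _

/-- The stopped path `x(· ∧ t)`. -/
def stopPath {n : ℕ} {h T : ℝ} (t : ℝ) (x : PathSp n h T) : PathSp n h T :=
  x.comp ⟨stopTime h T t, continuous_stopTime h T t⟩

/-- Evaluation of a path at a real time (times outside `[-h,T]` are projected). -/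
def evalP {n : ℕ} {h T : ℝ} (x : PathSp n h T) (τ : ℝ) : Euc n :=
  if hc : -h ≤ T then x (Set.projIcc (-h) T hc τ) else 0

/-- The `L¹([0,T])` distance between two functions. -/
def L1dist (T : ℝ) (c₁ c₂ : ℝ → ℝ) : ℝ := ∫ τ in Set.Icc (0:ℝ) T, |c₁ τ - c₂ τ|

/-- A nonnegative function in `L¹([0,T],ℝ)`. -/
def IntegNonneg (T : ℝ) (c : ℝ → ℝ) : Prop :=
  IntegrableOn c (Set.Icc 0 T) volume ∧ ∀ τ ∈ Set.Icc (0:ℝ) T, 0 ≤ c τ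

/-- `AC(t,x(·))`, presented with an explicit derivative witness: pairs `(y, y')`
such that `y(·∧t) = x(·∧t)`, `y'` is integrable on `[t,T]`, and `y` is the
indefinite integral of `y'` on `[t,T]` (i.e. `y|_{[t,T]}` is absolutely continuous
with a.e. derivative `y'`). -/
def ACPair {n : ℕ} {h T : ℝ} (t : ℝ) (x : PathSp n h T) :
    Set (PathSp n h T × (ℝ → Euc n)) :=
  {p | stopPath t p.1 = stopPath t x ∧ IntervalIntegrable p.2 volume t T ∧
       ∀ τ ∈ Set.Icc t T, evalP p.1 τ = evalP p.1 t + ∫ ξ in t..τ, p.2 ξ}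

/-- The set `AC(t,x(·))`. -/
def ACSet {n : ℕ} {h T : ℝ} (t : ℝ) (x : PathSp n h T) : Set (PathSp n h T) :=
  {y | ∃ y', (y, y') ∈ ACPair t x}

/-- Pairs `(y, y')` with `y ∈ Y(t,x(·);c(·))` and derivative witness `y'`. -/
def YPair {n : ℕ} {h T : ℝ} (t : ℝ) (x : PathSp n h T) (c : ℝ → ℝ) :
    Set (PathSp n h T × (ℝ → Euc n)) :=
  {p | p ∈ ACPair t x ∧
       ∀ᵐ τ ∂(volume.restrict (Set.Icc t T)), ‖p.2 τ‖ ≤ c τ * (1 + ‖stopPath τ p.1‖)}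

/-- The set `Y(t,x(·);c(·))`. -/
def YSet {n : ℕ} {h T : ℝ} (t : ℝ) (x : PathSp n h T) (c : ℝ → ℝ) :
    Set (PathSp n h T) :=
  {y | ∃ y', (y, y') ∈ YPair t x c}

/-- Condition (A.1): measurability in `t` on `[0,T]`. -/
def CondA1 {n : ℕ} {h T : ℝ} (H : ℝ → PathSp n h T → Euc n → ℝ) : Prop :=
  ∀ (x : PathSp n h T) (s : Euc n),
    Measurable ((Set.Icc (0:ℝ) T).restrict (fun t => H t x s))

/-- Condition (A.2): continuity in `(x,s)` for a.e. `t`. -/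
def CondA2 {n : ℕ} {h T : ℝ} (H : ℝ → PathSp n h T → Euc n → ℝ) : Prop :=
  ∃ E : Set ℝ, E ⊆ Set.Icc 0 T ∧ volume E = ENNReal.ofReal T ∧
    ∀ t ∈ E, Continuous (fun p : PathSp n h T × Euc n => H t p.1 p.2)

/-- Condition (A.3) for a given compact set `D` and function `λ_H(·;D)`. -/
def CondA3For {n : ℕ} {h T : ℝ} (H : ℝ → PathSp n h T → Euc n → ℝ)
    (D : Set (PathSp n h T)) (lam : ℝ → ℝ) : Prop :=
  IntegNonneg T lam ∧
  ∀ x₁ ∈ D, ∀ x₂ ∈ D, ∀ s : Euc n,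
    ∃ E : Set ℝ, E ⊆ Set.Icc 0 T ∧ volume E = ENNReal.ofReal T ∧
      ∀ t ∈ E, |H t x₁ s - H t x₂ s| ≤
        lam t * (1 + ‖s‖) * ‖stopPath t x₁ - stopPath t x₂‖

/-- Condition (A.3). -/
def CondA3 {n : ℕ} {h T : ℝ} (H : ℝ → PathSp n h T → Euc n → ℝ) : Prop :=
  ∀ D : Set (PathSp n h T), IsCompact D → ∃ lam : ℝ → ℝ, CondA3For H D lam

/-- Condition (A.4), with the function `c_H(·)` made explicit. -/
def CondA4 {n : ℕ} {h T : ℝ} (H : ℝ → PathSp n h T → Euc n → ℝ) (cH : ℝ → ℝ) : Prop :=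
  IntegNonneg T cH ∧
  ∃ E : Set ℝ, E ⊆ Set.Icc 0 T ∧ volume E = ENNReal.ofReal T ∧
    ∀ t ∈ E, ∀ (x : PathSp n h T) (s₁ s₂ : Euc n),
      |H t x s₁ - H t x s₂| ≤ cH t * (1 + ‖stopPath t x‖) * ‖s₁ - s₂‖

/-- Condition (A.5) for a given compact set `D` and function `m_H(·;D)`. -/
def CondA5For {n : ℕ} {h T : ℝ} (H : ℝ → PathSp n h T → Euc n → ℝ)
    (D : Set (PathSp n h T)) (m : ℝ → ℝ) : Prop :=
  IntegNonneg T m ∧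
  ∀ x ∈ D, ∃ E : Set ℝ, E ⊆ Set.Icc 0 T ∧ volume E = ENNReal.ofReal T ∧
    ∀ t ∈ E, |H t x (0 : Euc n)| ≤ m t

/-- Condition (A.5). -/
def CondA5 {n : ℕ} {h T : ℝ} (H : ℝ → PathSp n h T → Euc n → ℝ) : Prop :=
  ∀ D : Set (PathSp n h T), IsCompact D → ∃ m : ℝ → ℝ, CondA5For H D m

/-- Conditions (A.1)–(A.5), with the function `c_H(·)` from (A.4) made explicit. -/
def CondA {n : ℕ} {h T : ℝ} (H : ℝ → PathSp n h T → Euc n → ℝ) (cH : ℝ → ℝ) : Prop :=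
  CondA1 H ∧ CondA2 H ∧ CondA3 H ∧ CondA4 H cH ∧ CondA5 H

/-- A functional `φ` on `[0,T] × C` is non-anticipative. -/
def NonAnticipative {n : ℕ} {h T : ℝ} (φ : ℝ → PathSp n h T → ℝ) : Prop :=
  ∀ t ∈ Set.Icc (0:ℝ) T, ∀ x : PathSp n h T, φ t x = φ t (stopPath t x)

/-- Property (U) from the definition of an upper solution. -/
def PropU {n : ℕ} {h T : ℝ} (H : ℝ → PathSp n h T → Euc n → ℝ) (cH : ℝ → ℝ)
    (φ : ℝ → PathSp n h T → ℝ) : Prop :=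
  ∀ t ∈ Set.Ico (0:ℝ) T, ∀ x : PathSp n h T, ∀ s : Euc n, ∀ τ ∈ Set.Ioc t T,
    ∃ p ∈ YPair t x cH,
      φ τ p.1 - ∫ ξ in t..τ, (@inner ℝ _ _ s (p.2 ξ) - H ξ p.1 s) ≤ φ t x

/-- Property (L) from the definition of a lower solution. -/
def PropL {n : ℕ} {h T : ℝ} (H : ℝ → PathSp n h T → Euc n → ℝ) (cH : ℝ → ℝ)
    (φ : ℝ → PathSp n h T → ℝ) : Prop :=
  ∀ t ∈ Set.Ico (0:ℝ) T, ∀ x : PathSp n h T, ∀ s : Euc n, ∀ τ ∈ Set.Ioc t T,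
    ∃ p ∈ YPair t x cH,
      φ t x ≤ φ τ p.1 - ∫ ξ in t..τ, (@inner ℝ _ _ s (p.2 ξ) - H ξ p.1 s)

/-- Upper solution of the Cauchy problem for `H` (with `c_H` from (A.4)) and `σ`. -/
def UpperSol {n : ℕ} {h T : ℝ} (H : ℝ → PathSp n h T → Euc n → ℝ) (cH : ℝ → ℝ)
    (σ : PathSp n h T → ℝ) (φ : ℝ → PathSp n h T → ℝ) : Prop :=
  NonAnticipative φ ∧
  LowerSemicontinuousOn (fun p : ℝ × PathSp n h T => φ p.1 p.2)
    (Set.Icc 0 T ×ˢ (Set.univ : Set (PathSp n h T))) ∧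
  (∀ x : PathSp n h T, σ x ≤ φ T x) ∧
  PropU H cH φ

/-- Lower solution of the Cauchy problem for `H` (with `c_H` from (A.4)) and `σ`. -/
def LowerSol {n : ℕ} {h T : ℝ} (H : ℝ → PathSp n h T → Euc n → ℝ) (cH : ℝ → ℝ)
    (σ : PathSp n h T → ℝ) (φ : ℝ → PathSp n h T → ℝ) : Prop :=
  NonAnticipative φ ∧
  UpperSemicontinuousOn (fun p : ℝ × PathSp n h T => φ p.1 p.2)
    (Set.Icc 0 T ×ˢ (Set.univ : Set (PathSp n h T))) ∧
  (∀ x : PathSp n h T, φ T x ≤ σ x) ∧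
  PropL H cH φ

/-- Minimax solution of the Cauchy problem. -/
def MinimaxSol {n : ℕ} {h T : ℝ} (H : ℝ → PathSp n h T → Euc n → ℝ) (cH : ℝ → ℝ)
    (σ : PathSp n h T → ℝ) (φ : ℝ → PathSp n h T → ℝ) : Prop :=
  UpperSol H cH σ φ ∧ LowerSol H cH σ φ

/-- `φ` is ci-differentiable at `(t,x(·))` with ci-derivatives `a = ∂ₜφ(t,x(·))`
and `g = ∇φ(t,x(·))`. -/
def HasCiDeriv {n : ℕ} {h T : ℝ} (φ : ℝ → PathSp n h T → ℝ)
    (t : ℝ) (x : PathSp n h T) (a : ℝ) (g : Euc n) : Prop :=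
  ∀ p ∈ ACPair t x, ∃ o : ℝ → ℝ,
    (∀ τ ∈ Set.Ioc t T,
      φ τ p.1 - φ t x =
        a * (τ - t) + @inner ℝ _ _ g (evalP p.1 τ - evalP x t) + o (τ - t)) ∧
    Tendsto (fun τ => o (τ - t) / (τ - t + ∫ ξ in t..τ, ‖p.2 ξ‖))
      (nhdsWithin t (Set.Ioi t)) (nhds 0)

/-- `φ ∈ Φ`, with the ci-derivatives `Dt = ∂ₜφ`, `Dx = ∇φ` and the full-measure
set `Eφ` of ci-differentiability made explicit. -/
structure IsInPhi {n : ℕ} {h T : ℝ} (φ : ℝ → PathSp n h T → ℝ)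
    (Dt : ℝ → PathSp n h T → ℝ) (Dx : ℝ → PathSp n h T → Euc n)
    (Eφ : Set ℝ) : Prop where
  cont : ContinuousOn (fun p : ℝ × PathSp n h T => φ p.1 p.2)
    (Set.Icc 0 T ×ˢ (Set.univ : Set (PathSp n h T)))
  absCont : ∀ t ∈ Set.Ico (0:ℝ) T, ∀ x : PathSp n h T, ∀ p ∈ ACPair t x,
    ∀ θ ∈ Set.Ioo t T, ∃ g : ℝ → ℝ, IntervalIntegrable g volume t θ ∧
      ∀ τ ∈ Set.Icc t θ, φ τ p.1 = φ t p.1 + ∫ ξ in t..τ, g ξ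
  Esub : Eφ ⊆ Set.Ico 0 T
  Efull : volume Eφ = ENNReal.ofReal T
  ciDiff : ∀ t ∈ Eφ, ∀ x : PathSp n h T, HasCiDeriv φ t x (Dt t x) (Dx t x)
  measD : ∀ x : PathSp n h T, Measurable (Eφ.restrict (fun t => (Dt t x, Dx t x)))
  contD : ∀ t ∈ Eφ, Continuous (fun x : PathSp n h T => (Dt t x, Dx t x))
  bddD : ∀ D : Set (PathSp n h T), IsCompact D → ∀ θ ∈ Set.Ico (0:ℝ) T,
    ∃ m : ℝ → ℝ, (IntegrableOn m (Set.Icc 0 θ) volume ∧ ∀ τ ∈ Set.Icc (0:ℝ) θ, 0 ≤ m τ) ∧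
      ∃ ℓ : ℝ, 0 < ℓ ∧ ∀ t ∈ Eφ ∩ Set.Icc 0 θ, ∀ x ∈ D, |Dt t x| ≤ m t ∧ ‖Dx t x‖ ≤ ℓ

/-- Semiclassical solution of the Cauchy problem (with derivative data). -/
def SemiclassicalSol {n : ℕ} {h T : ℝ} (H : ℝ → PathSp n h T → Euc n → ℝ)
    (σ : PathSp n h T → ℝ) (φ : ℝ → PathSp n h T → ℝ)
    (Dt : ℝ → PathSp n h T → ℝ) (Dx : ℝ → PathSp n h T → Euc n) (Eφ : Set ℝ) : Prop :=
  IsInPhi φ Dt Dx Eφ ∧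
  (∀ t ∈ Eφ, ∀ x : PathSp n h T, Dt t x + H t x (Dx t x) = 0) ∧
  ∀ x : PathSp n h T, φ T x = σ x

/-- The Steklov transform of `H` with respect to the first (time) variable,
with `H` extended by `0` outside `[0,T]`. -/
def steklov {n : ℕ} {h T : ℝ} (H : ℝ → PathSp n h T → Euc n → ℝ) (k : ℕ)
    (t : ℝ) (x : PathSp n h T) (s : Euc n) : ℝ :=
  ((k : ℝ) / 2) * ∫ τ in (t - (k : ℝ)⁻¹)..(t + (k : ℝ)⁻¹),
    (if τ ∈ Set.Icc (0:ℝ) T then H τ (stopPath t x) s else 0)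

/-! ### Differential game definitions -/

/-- Admissible controls with values in `P`. -/
def Ctrl {m : ℕ} (P : Set (Euc m)) : Set (ℝ → Euc m) :=
  {u | Measurable u ∧ ∀ τ, u τ ∈ P}

/-- Non-anticipative strategies mapping `Q`-valued controls to `P`-valued controls
on the interval `[t,T]`. -/
def NAStrat {mP mQ : ℕ} (P : Set (Euc mP)) (Q : Set (Euc mQ)) (t T : ℝ) :
    Set ((ℝ → Euc mQ) → ℝ → Euc mP) :=
  {α | (∀ v ∈ Ctrl Q, α v ∈ Ctrl P) ∧
    ∀ τ ∈ Set.Icc t T, ∀ v ∈ Ctrl Q, ∀ v' ∈ Ctrl Q,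
      (∀ᵐ ξ ∂(volume.restrict (Set.Icc t τ)), v ξ = v' ξ) →
      (∀ᵐ ξ ∂(volume.restrict (Set.Icc t τ)), α v ξ = α v' ξ)}

/-- `(y, y')` is (the derivative-witnessed) motion of the time-delay system
generated by `f` from `(t,x(·))` under controls `u(·)`, `v(·)`. -/
def IsMotion {n : ℕ} {h T : ℝ} {mP mQ : ℕ}
    (f : ℝ → PathSp n h T → Euc mP → Euc mQ → Euc n)
    (t : ℝ) (x : PathSp n h T) (u : ℝ → Euc mP) (v : ℝ → Euc mQ)
    (p : PathSp n h T × (ℝ → Euc n)) : Prop :=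
  p ∈ ACPair t x ∧
  ∀ᵐ τ ∂(volume.restrict (Set.Icc t T)), p.2 τ = f τ p.1 (u τ) (v τ)

/-- The set of values of the cost functional along motions (a singleton when
the motion exists and is unique). -/
def costVals {n : ℕ} {h T : ℝ} {mP mQ : ℕ}
    (f : ℝ → PathSp n h T → Euc mP → Euc mQ → Euc n)
    (χ : ℝ → PathSp n h T → Euc mP → Euc mQ → ℝ) (σ : PathSp n h T → ℝ)
    (t : ℝ) (x : PathSp n h T) (u : ℝ → Euc mP) (v : ℝ → Euc mQ) : Set ℝ :=
  {r | ∃ p : PathSp n h T × (ℝ → Euc n), IsMotion f t x u v p ∧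
        r = σ p.1 - ∫ τ in t..T, χ τ p.1 (u τ) (v τ)}

/-- The lower value `ρ⁻(t,x(·))` of the differential game. -/
def lowerValue {n : ℕ} {h T : ℝ} {mP mQ : ℕ} (P : Set (Euc mP)) (Q : Set (Euc mQ))
    (f : ℝ → PathSp n h T → Euc mP → Euc mQ → Euc n)
    (χ : ℝ → PathSp n h T → Euc mP → Euc mQ → ℝ) (σ : PathSp n h T → ℝ)
    (t : ℝ) (x : PathSp n h T) : ℝ :=
  sInf ((fun α => sSup (⋃ v ∈ Ctrl Q, costVals f χ σ t x (α v) v)) '' NAStrat P Q t T)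

/-- The upper value `ρ⁺(t,x(·))` of the differential game. -/
def upperValue {n : ℕ} {h T : ℝ} {mP mQ : ℕ} (P : Set (Euc mP)) (Q : Set (Euc mQ))
    (f : ℝ → PathSp n h T → Euc mP → Euc mQ → Euc n)
    (χ : ℝ → PathSp n h T → Euc mP → Euc mQ → ℝ) (σ : PathSp n h T → ℝ)
    (t : ℝ) (x : PathSp n h T) : ℝ :=
  sSup ((fun β => sInf (⋃ u ∈ Ctrl P, costVals f χ σ t x u (β u))) '' NAStrat Q P t T)

/-- The lower Hamiltonian `H⁻` (defined via the full-measure set `EC` from (C.2)). -/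
def Hlow {n : ℕ} {h T : ℝ} {mP mQ : ℕ} (P : Set (Euc mP)) (Q : Set (Euc mQ))
    (f : ℝ → PathSp n h T → Euc mP → Euc mQ → Euc n)
    (χ : ℝ → PathSp n h T → Euc mP → Euc mQ → ℝ) (EC : Set ℝ)
    (τ : ℝ) (y : PathSp n h T) (s : Euc n) : ℝ :=
  if τ ∈ EC then
    sSup ((fun v => sInf ((fun u => @inner ℝ _ _ s (f τ y u v) - χ τ y u v) '' P)) '' Q)
  else 0

/-- The upper Hamiltonian `H⁺` (defined via the full-measure set `EC` from (C.2)). -/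
def Hup {n : ℕ} {h T : ℝ} {mP mQ : ℕ} (P : Set (Euc mP)) (Q : Set (Euc mQ))
    (f : ℝ → PathSp n h T → Euc mP → Euc mQ → Euc n)
    (χ : ℝ → PathSp n h T → Euc mP → Euc mQ → ℝ) (EC : Set ℝ)
    (τ : ℝ) (y : PathSp n h T) (s : Euc n) : ℝ :=
  if τ ∈ EC then
    sInf ((fun u => sSup ((fun v => @inner ℝ _ _ s (f τ y u v) - χ τ y u v) '' Q)) '' P)
  else 0

/-- Assumption (C) on the data `(f, χ, σ)` of the differential game, with the
full-measure set `EC` from (C.2) and the function `c_f(·)` from (C.4) explicit. -/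
structure AssumpC {n : ℕ} {h T : ℝ} {mP mQ : ℕ} (P : Set (Euc mP)) (Q : Set (Euc mQ))
    (f : ℝ → PathSp n h T → Euc mP → Euc mQ → Euc n)
    (χ : ℝ → PathSp n h T → Euc mP → Euc mQ → ℝ)
    (σ : PathSp n h T → ℝ) (EC : Set ℝ) (cf : ℝ → ℝ) : Prop where
  meas : ∀ (y : PathSp n h T) (u : Euc mP) (v : Euc mQ),
    Measurable ((Set.Icc (0:ℝ) T).restrict (fun τ => (f τ y u v, χ τ y u v)))
  ECsub : EC ⊆ Set.Icc 0 T
  ECfull : volume EC = ENNReal.ofReal T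
  contOn : ∀ τ ∈ EC, ContinuousOn
    (fun p : PathSp n h T × Euc mP × Euc mQ => (f τ p.1 p.2.1 p.2.2, χ τ p.1 p.2.1 p.2.2))
    ((Set.univ : Set (PathSp n h T)) ×ˢ P ×ˢ Q)
  lip : ∀ D : Set (PathSp n h T), IsCompact D → ∃ lam : ℝ → ℝ, IntegNonneg T lam ∧
    ∃ E : Set ℝ, E ⊆ Set.Icc 0 T ∧ volume E = ENNReal.ofReal T ∧
      ∀ τ ∈ E, ∀ y₁ ∈ D, ∀ y₂ ∈ D, ∀ u ∈ P, ∀ v ∈ Q,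
        ‖f τ y₁ u v - f τ y₂ u v‖ + |χ τ y₁ u v - χ τ y₂ u v| ≤
          lam τ * ‖stopPath τ y₁ - stopPath τ y₂‖
  growth : IntegNonneg T cf ∧
    ∃ E : Set ℝ, E ⊆ Set.Icc 0 T ∧ volume E = ENNReal.ofReal T ∧
      ∀ τ ∈ E, ∀ y : PathSp n h T, ∀ u ∈ P, ∀ v ∈ Q,
        ‖f τ y u v‖ ≤ cf τ * (1 + ‖stopPath τ y‖)
  bdd : ∀ D : Set (PathSp n h T), IsCompact D → ∃ m : ℝ → ℝ, IntegNonneg T m ∧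
    ∃ E : Set ℝ, E ⊆ Set.Icc 0 T ∧ volume E = ENNReal.ofReal T ∧
      ∀ τ ∈ E, ∀ y ∈ D, ∀ u ∈ P, ∀ v ∈ Q, |χ τ y u v| ≤ m τ
  sigC : Continuous σ


/-! ### Auxiliary facts -/

/-- A pointwise inequality on a set of full (outer) measure holds a.e. -/
lemma ae_le_of_full {a b : ℝ} (f g : ℝ → ℝ)
    (hf : AEMeasurable f (volume.restrict (Set.Icc a b)))
    (hg : AEMeasurable g (volume.restrict (Set.Icc a b)))
    (E : Set ℝ) (hE : E ⊆ Set.Icc a b) (hv : volume E = ENNReal.ofReal (b - a))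
    (hle : ∀ t ∈ E, f t ≤ g t) :
    ∀ᵐ t ∂(volume.restrict (Set.Icc a b)), f t ≤ g t := by
  have hN : NullMeasurableSet {t | f t ≤ g t} (volume.restrict (Set.Icc a b)) :=
    nullMeasurableSet_le hf hg
  rw [ae_iff_measure_eq hN]
  apply le_antisymm (measure_mono (subset_univ _))
  calc (volume.restrict (Set.Icc a b)) univ = ENNReal.ofReal (b - a) := by simp
    _ = (volume.restrict (Set.Icc a b)) E := by rw [Measure.restrict_eq_self _ hE, hv]
    _ ≤ _ := measure_mono hle

lemma stopTime_stopTime {h T a b : ℝ} (hab : a ≤ b) (τ : Set.Icc (-h) T) :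
    stopTime h T b (stopTime h T a τ) = stopTime h T a τ := by
  apply Subtype.ext
  simp only [stopTime]
  have h1 := τ.2.1
  rcases le_total τ.1 a with h1 | h1 <;> rcases le_total (-h) a with h2 | h2 <;>
    rcases le_total (-h) b with h3 | h3 <;> grind

lemma stopTime_stopTime' {h T a b : ℝ} (hab : a ≤ b) (τ : Set.Icc (-h) T) :
    stopTime h T a (stopTime h T b τ) = stopTime h T a τ := by
  apply Subtype.ext
  simp only [stopTime]
  have h1 := τ.2.1
  grind

lemma stopPath_apply {n : ℕ} {h T : ℝ} (t : ℝ) (x : PathSp n h T) (τ : Set.Icc (-h) T) :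
    stopPath t x τ = x (stopTime h T t τ) := rfl

lemma stopPath_stopPath {n : ℕ} {h T a b : ℝ} (hab : a ≤ b) (x : PathSp n h T) :
    stopPath a (stopPath b x) = stopPath a x := by
  ext1 τ
  rw [stopPath_apply, stopPath_apply, stopPath_apply, stopTime_stopTime hab]

lemma stopPath_stopPath' {n : ℕ} {h T a b : ℝ} (hab : a ≤ b) (x : PathSp n h T) :
    stopPath b (stopPath a x) = stopPath a x := by
  ext1 τ
  rw [stopPath_apply, stopPath_apply, stopPath_apply, stopTime_stopTime' hab]

lemma stopPath_sub {n : ℕ} {h T : ℝ} (t : ℝ) (x y : PathSp n h T) :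
    stopPath t (x - y) = stopPath t x - stopPath t y := by
  ext1 τ
  simp [stopPath_apply]

lemma norm_stopPath_le {n : ℕ} {h T : ℝ} (t : ℝ) (x : PathSp n h T) :
    ‖stopPath t x‖ ≤ ‖x‖ := by
  rw [ContinuousMap.norm_le _ (norm_nonneg _)]
  intro τ
  rw [stopPath_apply]
  exact x.norm_coe_le_norm _

lemma norm_stopPath_mono {n : ℕ} {h T : ℝ} (x : PathSp n h T) :
    Monotone (fun t => ‖stopPath t x‖) := by
  intro a b hab
  simp only
  rw [← stopPath_stopPath hab]
  exact norm_stopPath_le _ _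

lemma stopPath_T {n : ℕ} {h T : ℝ} (x : PathSp n h T) : stopPath T x = x := by
  ext1 τ
  rw [stopPath_apply]
  congr 1
  apply Subtype.ext
  simp only [stopTime]
  rw [min_eq_left τ.2.2, max_eq_right τ.2.1]

lemma evalP_of_mem {n : ℕ} {h T : ℝ} (x : PathSp n h T) {τ : ℝ} (hτ : τ ∈ Set.Icc (-h) T) :
    evalP x τ = x ⟨τ, hτ⟩ := by
  have hc : -h ≤ T := hτ.1.trans hτ.2
  rw [evalP, dif_pos hc, Set.projIcc_of_mem hc hτ]

lemma evalP_sub {n : ℕ} {h T : ℝ} (x y : PathSp n h T) (τ : ℝ) :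
    evalP (x - y) τ = evalP x τ - evalP y τ := by
  unfold evalP
  split_ifs <;> simp

lemma stopTime_self {h T a : ℝ} {τ : ℝ} (hτ : τ ∈ Set.Icc (-h) T) (ha : τ ≤ a) :
    stopTime h T a ⟨τ, hτ⟩ = ⟨τ, hτ⟩ := by
  apply Subtype.ext
  simp only [stopTime]
  rw [min_eq_left ha, max_eq_right hτ.1]

lemma stopTime_ge {h T a : ℝ} (ha : a ∈ Set.Icc (-h) T) {τ : Set.Icc (-h) T} (haτ : a ≤ τ.1) :
    stopTime h T a τ = ⟨a, ha⟩ := by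
  apply Subtype.ext
  simp only [stopTime]
  rw [min_eq_right haτ, max_eq_right ha.1]

lemma evalP_stopPath {n : ℕ} {h T : ℝ} (x : PathSp n h T) {τ a : ℝ}
    (hτ : τ ∈ Set.Icc (-h) T) (ha : τ ≤ a) :
    evalP (stopPath a x) τ = evalP x τ := by
  rw [evalP_of_mem _ hτ, evalP_of_mem _ hτ, stopPath_apply, stopTime_self hτ ha]

lemma norm_evalP_le {n : ℕ} {h T : ℝ} (x : PathSp n h T) {τ a : ℝ}
    (hτ : τ ∈ Set.Icc (-h) T) (ha : τ ≤ a) :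
    ‖evalP x τ‖ ≤ ‖stopPath a x‖ := by
  rw [← evalP_stopPath x hτ ha, evalP_of_mem _ hτ]
  exact ContinuousMap.norm_coe_le_norm _ _

/-- The norm of the path stopped at `b` compared with the path stopped at `a ≤ b`. -/
lemma norm_stopPath_le_of {n : ℕ} {h T : ℝ} (w : PathSp n h T) {a b C : ℝ}
    (ha : -h ≤ a) (hab : a ≤ b) (hb : b ≤ T) (h1 : ‖stopPath a w‖ ≤ C)
    (h2 : ∀ r ∈ Set.Icc a b, ‖evalP w r‖ ≤ C) : ‖stopPath b w‖ ≤ C := by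
  rw [ContinuousMap.norm_le _ ((norm_nonneg _).trans h1)]
  intro τ
  rw [stopPath_apply]
  rcases le_total a τ.1 with h3 | h3
  · have hm : min τ.1 b ∈ Set.Icc a b := ⟨le_min h3 hab, min_le_right _ _⟩
    have := h2 _ hm
    rwa [evalP_of_mem w ⟨ha.trans hm.1, hm.2.trans hb⟩,
      show (⟨min τ.1 b, ⟨ha.trans hm.1, hm.2.trans hb⟩⟩ : Set.Icc (-h) T) = stopTime h T b τ from
        Subtype.ext (by simp only [stopTime]; rw [max_eq_right (ha.trans hm.1)])] at this
  · have e1 : stopTime h T b τ = τ := stopTime_self τ.2 (h3.trans hab)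
    have e2 : stopTime h T a τ = τ := stopTime_self τ.2 h3
    rw [e1, ← e2, ← stopPath_apply]
    exact (ContinuousMap.norm_coe_le_norm _ _).trans h1

lemma exists_partition {t T : ℝ} (htT : t < T) (G : ℝ → ℝ) (hG : Continuous G)
    {δ : ℝ} (hδ : 0 < δ) :
    ∃ (N : ℕ) (τ : ℕ → ℝ), τ 0 = t ∧ τ N = T ∧ StrictMono τ ∧
      ∀ i < N, |G (τ (i + 1)) - G (τ i)| ≤ δ := by
  have hu := (isCompact_Icc (a := t) (b := T)).uniformContinuousOn_of_continuous hG.continuousOn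
  rw [Metric.uniformContinuousOn_iff] at hu
  obtain ⟨ρ, hρ, hu⟩ := hu δ hδ
  obtain ⟨M, hM⟩ := exists_nat_gt ((T - t) / ρ)
  have hTt : 0 < T - t := by linarith
  have hM0 : (0:ℝ) < M := lt_trans (by positivity) hM
  have hstep : (T - t) / M < ρ := by
    rw [div_lt_iff₀ hρ] at hM
    rw [div_lt_iff₀ hM0]; linarith
  have hs0 : 0 < (T - t) / M := by positivity
  have hmem : ∀ i : ℕ, i ≤ M → t + i * ((T - t) / M) ∈ Set.Icc t T := by
    intro i hi
    have hi' : (i:ℝ) ≤ M := by exact_mod_cast hi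
    constructor
    · have : 0 ≤ (i:ℝ) * ((T - t) / M) := by positivity
      linarith
    · have : (i:ℝ) * ((T - t) / M) ≤ M * ((T - t) / M) := by gcongr
      rw [mul_div_cancel₀ _ hM0.ne'] at this
      linarith
  refine ⟨M, fun i => t + i * ((T - t) / M), by simp, ?_, ?_, ?_⟩
  · simp only
    rw [mul_div_cancel₀ _ hM0.ne']; ring
  · apply strictMono_nat_of_lt_succ
    intro i
    push_cast
    nlinarith
  · intro i hi
    have := hu _ (hmem (i + 1) hi) _ (hmem i hi.le) (by
      rw [Real.dist_eq]
      push_cast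
      rw [show t + ((i:ℝ) + 1) * ((T - t) / M) - (t + i * ((T - t) / M)) = (T - t) / M by ring,
        abs_of_pos hs0]
      exact hstep)
    rw [Real.dist_eq] at this
    exact this.le

/-- The extension of a function on `[0,T]` by zero. -/
lemma ext_integrable {T : ℝ} {c : ℝ → ℝ} (hc : IntegNonneg T c) :
    Integrable ((Set.Icc 0 T).indicator c) ∧ ∀ τ, 0 ≤ (Set.Icc 0 T).indicator c τ :=
  ⟨hc.1.integrable_indicator measurableSet_Icc,
    fun τ => Set.indicator_nonneg (fun τ hτ => hc.2 τ hτ) τ⟩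

lemma continuous_prim {g : ℝ → ℝ} (hg : Integrable g) (t : ℝ) :
    Continuous (fun τ => ∫ ξ in t..τ, g ξ) :=
  intervalIntegral.continuous_primitive (fun _ _ => hg.intervalIntegrable) t

lemma prim_sub {g : ℝ → ℝ} (hg : Integrable g) (t a b : ℝ) :
    (∫ ξ in t..b, g ξ) - (∫ ξ in t..a, g ξ) = ∫ ξ in a..b, g ξ :=
  intervalIntegral.integral_interval_sub_left hg.intervalIntegrable hg.intervalIntegrable

/-- Increments of motions. -/
lemma YPair_inc {n : ℕ} {h T : ℝ} (hh : 0 ≤ h) {t : ℝ} (ht : t ∈ Set.Ico (0:ℝ) T)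
    {x : PathSp n h T} {c : ℝ → ℝ} (hc : IntegNonneg T c)
    {p : PathSp n h T × (ℝ → Euc n)} (hp : p ∈ YPair t x c) {a b : ℝ} (ha : t ≤ a) (hab : a ≤ b)
    (hb : b ≤ T) :
    ‖evalP p.1 b - evalP p.1 a‖ ≤
      (∫ ξ in a..b, (Set.Icc 0 T).indicator c ξ) * (1 + ‖stopPath b p.1‖) := by
  obtain ⟨⟨_, hint, hAC⟩, hbd⟩ := hp
  have hsub : ∀ u v, u ∈ Set.Icc t T → v ∈ Set.Icc t T → IntervalIntegrable p.2 volume u v := by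
    intro u v hu hv
    apply hint.mono_set
    rw [Set.uIcc_of_le ht.2.le]
    exact Set.uIcc_subset_Icc hu hv
  have hti : t ∈ Set.Icc t T := ⟨le_rfl, ht.2.le⟩
  have hai : a ∈ Set.Icc t T := ⟨ha, hab.trans hb⟩
  have hbi : b ∈ Set.Icc t T := ⟨ha.trans hab, hb⟩
  rw [hAC b hbi, hAC a hai, add_sub_add_left_eq_sub,
    intervalIntegral.integral_interval_sub_left (hsub _ _ hti hbi) (hsub _ _ hti hai),
    ← intervalIntegral.integral_mul_const]
  apply intervalIntegral.norm_integral_le_of_norm_le hab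
  · rw [ae_restrict_iff' measurableSet_Icc] at hbd
    filter_upwards [hbd] with ξ hξ hξ'
    have hξ2 : ξ ∈ Set.Icc t T := ⟨ha.trans hξ'.1.le, hξ'.2.trans hb⟩
    have hξ3 : ξ ∈ Set.Icc 0 T := ⟨ht.1.trans hξ2.1, hξ2.2⟩
    refine (hξ hξ2).trans ?_
    rw [Set.indicator_of_mem hξ3]
    have := norm_stopPath_mono p.1 hξ'.2
    simp only at this
    have := hc.2 ξ hξ3
    gcongr
  · exact ((ext_integrable hc).1.mul_const _).intervalIntegrable

/-- A priori bound on motions. -/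
lemma YSet_bounded {n : ℕ} {h T : ℝ} (hh : 0 ≤ h) {t : ℝ} (ht : t ∈ Set.Ico (0:ℝ) T)
    (x : PathSp n h T) {c : ℝ → ℝ} (hc : IntegNonneg T c) :
    ∃ R : ℝ, ∀ y ∈ YSet t x c, 1 + ‖y‖ ≤ R := by
  have hci := ext_integrable hc
  obtain ⟨N, τ, h0, hN, hmono, hstep⟩ := exists_partition ht.2
    (fun τ => ∫ ξ in t..τ, (Set.Icc 0 T).indicator c ξ) (continuous_prim hci.1 t)
    (δ := 1 / 2) (by norm_num)
  refine ⟨2 ^ N * (1 + ‖stopPath t x‖), ?_⟩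
  rintro y ⟨y', hp⟩
  have key : ∀ i ≤ N, 1 + ‖stopPath (τ i) y‖ ≤ 2 ^ i * (1 + ‖stopPath t x‖) := by
    intro i
    induction i with
    | zero =>
      intro _
      rw [h0, show stopPath t y = stopPath t x from hp.1.1]
      simp
    | succ i ih =>
      intro hi
      have ih := ih (by omega)
      have hta : t ≤ τ i := h0 ▸ hmono.monotone (Nat.zero_le i)
      have hab : τ i ≤ τ (i + 1) := hmono.monotone (Nat.le_succ i)
      have hbT : τ (i + 1) ≤ T := hN ▸ hmono.monotone hi
      have hs := hstep i (by omega)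
      rw [prim_sub hci.1] at hs
      have hs' := (le_abs_self _).trans hs
      have hle : ‖stopPath (τ (i + 1)) y‖ ≤
          ‖stopPath (τ i) y‖ + 1 / 2 * (1 + ‖stopPath (τ (i + 1)) y‖) := by
        apply norm_stopPath_le_of y (a := τ i) (by linarith [ht.1]) hab hbT
        · have := norm_nonneg (stopPath (τ (i + 1)) y)
          linarith
        · intro r hr
          have h1 := YPair_inc hh ht hc hp hta hr.1 (hr.2.trans hbT)
          simp only at h1
          have h2 : (∫ ξ in (τ i)..r, (Set.Icc 0 T).indicator c ξ) ≤ 1 / 2 := by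
            refine le_trans ?_ hs'
            have : 0 ≤ ∫ ξ in r..(τ (i+1)), (Set.Icc 0 T).indicator c ξ :=
              intervalIntegral.integral_nonneg hr.2 (fun u _ => hci.2 u)
            rw [← prim_sub hci.1 (τ i) r (τ (i+1))] at this
            linarith
          have h3 := norm_stopPath_mono y hr.2
          simp only at h3
          have h4 : ‖evalP y r‖ ≤ ‖evalP y (τ i)‖ + ‖evalP y r - evalP y (τ i)‖ := by
            have := norm_add_le (evalP y (τ i)) (evalP y r - evalP y (τ i))
            rwa [add_sub_cancel] at this
          have h5 : ‖evalP y (τ i)‖ ≤ ‖stopPath (τ i) y‖ :=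
            norm_evalP_le y ⟨by linarith [ht.1], hab.trans hbT⟩ le_rfl
          have h6 : (∫ ξ in (τ i)..r, (Set.Icc 0 T).indicator c ξ) * (1 + ‖stopPath r y‖)
              ≤ 1 / 2 * (1 + ‖stopPath (τ (i + 1)) y‖) := by
            gcongr
          linarith
      rw [pow_succ]
      linarith
  have := key N le_rfl
  rwa [hN, stopPath_T] at this

/-- Motions lie in a compact set. -/
lemma YSet_compact {n : ℕ} {h T : ℝ} (hh : 0 ≤ h) {t : ℝ} (ht : t ∈ Set.Ico (0:ℝ) T)
    (x : PathSp n h T) {c : ℝ → ℝ} (hc : IntegNonneg T c) :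
    ∃ D : Set (PathSp n h T), IsCompact D ∧ YSet t x c ⊆ D := by
  obtain ⟨R, hR⟩ := YSet_bounded hh ht x hc
  have hci := ext_integrable hc
  have htm : t ∈ Set.Icc (-h) T := ⟨by linarith [ht.1], ht.2.le⟩
  let Gf : ℝ → ℝ := fun τ => (∫ ξ in t..τ, (Set.Icc 0 T).indicator c ξ) * R
  have hGf : Continuous Gf := (continuous_prim hci.1 t).mul continuous_const
  let e := BoundedContinuousFunction.mkOfCompact (α := Set.Icc (-h) T) (β := Euc n)
  let I := ContinuousMap.isometryEquivBoundedOfCompact (Set.Icc (-h) T) (Euc n)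
  let A : Set (BoundedContinuousFunction (Set.Icc (-h) T) (Euc n)) := I '' (YSet t x c)
  have hcomp : IsCompact (closure A) := by
    apply BoundedContinuousFunction.arzela_ascoli (Metric.closedBall 0 R)
      (isCompact_closedBall _ _)
    · rintro f τ ⟨y, hy, rfl⟩
      have h1 := hR y hy
      have h2 := y.norm_coe_le_norm τ
      rw [mem_closedBall_zero_iff]
      change ‖y τ‖ ≤ R
      linarith
    · let b : Set.Icc (-h) T → Set.Icc (-h) T → ℝ := fun u v =>
        |Gf (max u.1 t) - Gf (max v.1 t)| + ‖x (stopTime h T t u) - x (stopTime h T t v)‖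
      have hinc : ∀ y ∈ YSet t x c, ∀ u v : Set.Icc (-h) T, u.1 ≤ v.1 →
          ‖y u - y v‖ ≤ b u v := by
        rintro y ⟨y', hy⟩ u v huv
        have hst : ∀ w : Set.Icc (-h) T, y (stopTime h T t w) = x (stopTime h T t w) := by
          intro w
          rw [← stopPath_apply, ← stopPath_apply]
          exact congrArg (fun z : PathSp n h T => z w) hy.1.1
        have hdec : ∀ w : Set.Icc (-h) T,
            y w = evalP y (max w.1 t) - evalP y t + x (stopTime h T t w) := by
          intro w
          rw [← hst]
          rcases le_total t w.1 with h3 | h3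
          · rw [max_eq_left h3, stopTime_ge htm h3, evalP_of_mem y w.2, evalP_of_mem y htm]
            simp
          · rw [max_eq_right h3, stopTime_self w.2 h3]
            simp
        have h1 := YPair_inc hh ht hc hy (a := max u.1 t) (b := max v.1 t) (le_max_right _ _)
          (max_le_max_right t huv) (max_le v.2.2 ht.2.le)
        simp only at h1
        rw [hdec u, hdec v]
        have h2 : ‖evalP y (max u.1 t) - evalP y (max v.1 t)‖ ≤
            |Gf (max u.1 t) - Gf (max v.1 t)| := by
          rw [norm_sub_rev, abs_sub_comm]
          refine h1.trans (le_trans ?_ (le_abs_self _))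
          simp only [Gf]
          rw [← sub_mul, prim_sub hci.1]
          have h4 := hR y ⟨y', hy⟩
          have h5 := norm_stopPath_le (max v.1 t) y
          have : 0 ≤ ∫ ξ in (max u.1 t)..(max v.1 t), (Set.Icc 0 T).indicator c ξ :=
              intervalIntegral.integral_nonneg (max_le_max_right t huv) (fun u _ => hci.2 u)
          apply mul_le_mul_of_nonneg_left _ this
          linarith
        have e1 : evalP y (max u.1 t) - evalP y t + x (stopTime h T t u) -
            (evalP y (max v.1 t) - evalP y t + x (stopTime h T t v)) =
            (evalP y (max u.1 t) - evalP y (max v.1 t)) +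
              (x (stopTime h T t u) - x (stopTime h T t v)) := by abel
        rw [e1]
        exact (norm_add_le _ _).trans (add_le_add h2 le_rfl)
      have hbsymm : ∀ u v, b u v = b v u := by
        intro u v
        simp only [b]
        rw [abs_sub_comm, norm_sub_rev]
      intro u
      apply Metric.equicontinuousAt_of_continuity_modulus (fun v => b u v)
      · have hcb : Continuous (fun v => b u v) := by
          have h1 : Continuous (fun v : Set.Icc (-h) T => Gf (max v.1 t)) :=
            hGf.comp (continuous_subtype_val.max continuous_const)
          have h2 : Continuous (fun v : Set.Icc (-h) T => x (stopTime h T t v)) :=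
            x.continuous.comp (continuous_stopTime h T t)
          exact (continuous_const.sub h1).abs.add (continuous_const.sub h2).norm
        have := hcb.tendsto u
        simpa [b] using this
      · apply Filter.Eventually.of_forall
        rintro v ⟨f, y, hy, rfl⟩
        rw [dist_eq_norm]
        change ‖y u - y v‖ ≤ b u v
        rcases le_total u.1 v.1 with h3 | h3
        · exact hinc y hy u v h3
        · rw [hbsymm, norm_sub_rev]
          exact hinc y hy v u h3
  refine ⟨I.symm '' closure A, hcomp.image I.symm.continuous, ?_⟩
  intro y hy
  exact ⟨I y, subset_closure ⟨y, hy, rfl⟩, by simp⟩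

/-- Concatenation of motions. -/
lemma YSet_concat {n : ℕ} {h T : ℝ} (hh : 0 ≤ h) {t : ℝ} (ht : t ∈ Set.Ico (0:ℝ) T)
    {x y : PathSp n h T} {c : ℝ → ℝ} (hy : y ∈ YSet t x c) {a : ℝ} (ha : a ∈ Set.Ico t T)
    {p : PathSp n h T × (ℝ → Euc n)} (hp : p ∈ YPair a y c) : p.1 ∈ YSet t x c := by
  obtain ⟨y', ⟨hy1, hy2, hy3⟩, hy4⟩ := hy
  obtain ⟨⟨hp1, hp2, hp3⟩, hp4⟩ := hp
  simp only at hy1 hy2 hy3 hy4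
  have hst : ∀ r ≤ a, stopPath r p.1 = stopPath r y := by
    intro r hr
    rw [← stopPath_stopPath hr, hp1, stopPath_stopPath hr]
  have hev : ∀ r, r ∈ Set.Icc t a → evalP p.1 r = evalP y r := by
    intro r hr
    have hm : r ∈ Set.Icc (-h) T := ⟨by linarith [ht.1, hr.1], hr.2.trans ha.2.le⟩
    rw [← evalP_stopPath p.1 hm hr.2, hp1, evalP_stopPath y hm hr.2]
  let z : ℝ → Euc n := fun ξ => if ξ ≤ a then y' ξ else p.2 ξ
  have hz1 : ∀ r ≤ a, ∀ ξ, ξ ∈ Set.uIoc t r → t ≤ r → z ξ = y' ξ := by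
    intro r hr ξ hξ htr
    rw [Set.uIoc_of_le htr] at hξ
    simp only [z]
    rw [if_pos (hξ.2.trans hr)]
  have hz2 : ∀ r ≥ a, ∀ ξ, ξ ∈ Set.uIoc a r → z ξ = p.2 ξ := by
    intro r hr ξ hξ
    rw [Set.uIoc_of_le hr] at hξ
    simp only [z]
    rw [if_neg (not_le.2 hξ.1)]
  have hiy : IntervalIntegrable z volume t a := by
    have : IntervalIntegrable y' volume t a := by
      apply hy2.mono_set
      rw [Set.uIcc_of_le ht.2.le, Set.uIcc_of_le ha.1]
      exact Set.Icc_subset_Icc_right ha.2.le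
    exact this.congr (fun ξ hξ => (hz1 a le_rfl ξ hξ ha.1).symm)
  have hip : IntervalIntegrable z volume a T :=
    hp2.congr (fun ξ hξ => (hz2 T ha.2.le ξ hξ).symm)
  refine ⟨z, ⟨?_, hiy.trans hip, ?_⟩, ?_⟩
  · simp only
    rw [hst t ha.1, hy1]
  · intro τ hτ
    simp only
    rw [hev t ⟨le_rfl, ha.1⟩]
    rcases le_total τ a with h1 | h1
    · rw [hev τ ⟨hτ.1, h1⟩, hy3 τ hτ]
      congr 1
      apply intervalIntegral.integral_congr_ae
      exact Filter.Eventually.of_forall (fun ξ hξ => (hz1 τ h1 ξ hξ hτ.1).symm)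
    · have hi2 : IntervalIntegrable z volume a τ := by
        apply hip.mono_set
        rw [Set.uIcc_of_le ha.2.le, Set.uIcc_of_le h1]
        exact Set.Icc_subset_Icc_right hτ.2
      rw [hp3 τ ⟨h1, hτ.2⟩, hev a ⟨ha.1, le_rfl⟩, hy3 a ⟨ha.1, ha.2.le⟩,
        ← intervalIntegral.integral_add_adjacent_intervals hiy hi2, add_assoc]
      congr 2
      · apply intervalIntegral.integral_congr_ae
        exact Filter.Eventually.of_forall (fun ξ hξ => (hz1 a le_rfl ξ hξ ha.1).symm)
      · apply intervalIntegral.integral_congr_ae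
        exact Filter.Eventually.of_forall (fun ξ hξ => (hz2 τ h1 ξ hξ).symm)
  · simp only
    rw [ae_restrict_iff' measurableSet_Icc] at hy4 hp4 ⊢
    filter_upwards [hy4, hp4] with ξ h1 h2 h3
    rcases le_or_gt ξ a with h4 | h4
    · simp only [z]
      rw [if_pos h4, hst ξ h4]
      exact h1 h3
    · simp only [z]
      rw [if_neg (not_le.2 h4)]
      exact h2 ⟨h4.le, h3.2⟩

lemma ham_aemeas {n : ℕ} {h T : ℝ} {H : ℝ → PathSp n h T → Euc n → ℝ} (hH : CondA1 H)
    (y : PathSp n h T) (s : Euc n) :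
    AEMeasurable (fun ξ => H ξ y s) (volume.restrict (Set.Icc 0 T)) :=
  aemeasurable_restrict_of_measurable_subtype measurableSet_Icc (hH y s)

lemma ham_integrable {n : ℕ} {h T : ℝ} {H : ℝ → PathSp n h T → Euc n → ℝ}
    {c : ℝ → ℝ} (hH : CondA H c) (y : PathSp n h T) (s : Euc n) :
    IntegrableOn (fun ξ => H ξ y s) (Set.Icc 0 T) volume := by
  obtain ⟨hA1, -, -, ⟨hc, E4, hE4, hE4v, h4⟩, hA5⟩ := hH
  obtain ⟨m, hm, hm5⟩ := hA5 {y} isCompact_singleton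
  obtain ⟨E5, hE5, hE5v, h5⟩ := hm5 y rfl
  have hms := ham_aemeas hA1 y s
  have hm0 := ham_aemeas hA1 y 0
  have a5 := ae_le_of_full (fun ξ => |H ξ y 0|) m hm0.abs hm.1.aemeasurable E5 hE5
    (by rw [hE5v, sub_zero]) h5
  have a4 := ae_le_of_full (fun ξ => |H ξ y s - H ξ y 0|) (fun ξ => c ξ * ((1 + ‖y‖) * ‖s‖))
    (hms.sub hm0).abs (hc.1.aemeasurable.mul_const _) E4 hE4
    (by rw [hE4v, sub_zero]) (by
      intro ξ hξ
      have h6 := h4 ξ hξ y s 0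
      rw [sub_zero] at h6
      refine h6.trans ?_
      have h7 := hc.2 ξ (hE4 hξ)
      have h8 := norm_stopPath_le ξ y
      rw [← mul_assoc]
      gcongr)
  apply Integrable.mono' (hm.1.add (hc.1.mul_const ((1 + ‖y‖) * ‖s‖))) hms.aestronglyMeasurable
  filter_upwards [a4, a5] with ξ h1 h2
  rw [Real.norm_eq_abs]
  have := abs_add_le (H ξ y s - H ξ y 0) (H ξ y 0)
  rw [sub_add_cancel] at this
  simp only [Pi.add_apply]
  linarith

/-- The penalty function. -/
def penF {n : ℕ} (m : ℝ) (v : Euc n) : ℝ := (m - ‖v‖) ^ 2 + ‖v‖ ^ 2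

/-- A supergradient of the penalty function. -/
def penG {n : ℕ} (m : ℝ) (v : Euc n) : Euc n := (4 - 2 * m * ‖v‖⁻¹) • v

lemma penF_lower {n : ℕ} (m : ℝ) (v : Euc n) : m ^ 2 / 2 ≤ penF m v := by
  unfold penF
  nlinarith [sq_nonneg (m - 2 * ‖v‖)]

lemma penG_norm {n : ℕ} {m : ℝ} {v : Euc n} (hv : ‖v‖ ≤ m) : ‖penG m v‖ ≤ 2 * m := by
  unfold penG
  have hm : 0 ≤ m := (norm_nonneg v).trans hv
  rw [norm_smul, Real.norm_eq_abs]
  rcases eq_or_ne v 0 with h0 | h0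
  · simp [h0, hm]
  · have hp : 0 < ‖v‖ := norm_pos_iff.2 h0
    rw [← abs_of_pos hp, ← abs_mul, abs_of_pos hp,
      show (4 - 2 * m * ‖v‖⁻¹) * ‖v‖ = 4 * ‖v‖ - 2 * m by field_simp]
    rw [abs_le]
    constructor <;> linarith

lemma penF_step {n : ℕ} {m m' η : ℝ} {v v' : Euc n} (hm : 0 ≤ m) (hv' : ‖v'‖ ≤ m')
    (hmm : m ≤ m') (hη : ‖v' - v‖ ≤ η) (hm' : m' ≤ max m (‖v'‖ + η)) :
    penF m' v' ≤ penF m v + @inner ℝ _ _ (penG m v) (v' - v) + 3 * η ^ 2 := by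
  have hη0 : 0 ≤ η := (norm_nonneg _).trans hη
  have h1 : (m' - ‖v'‖) ^ 2 ≤ (m - ‖v'‖) ^ 2 + η ^ 2 := by
    rcases le_max_iff.1 hm' with h2 | h2
    · rw [le_antisymm h2 hmm]
      nlinarith
    · have : (m' - ‖v'‖) ^ 2 ≤ η ^ 2 := by
        apply pow_le_pow_left₀ <;> linarith
      nlinarith [sq_nonneg (m - ‖v'‖)]
  obtain ⟨d, rfl⟩ : ∃ d, v' = v + d := ⟨v' - v, by abel⟩
  rw [add_sub_cancel_left] at hη ⊢
  have h2 : ‖v + d‖ ^ 2 = ‖v‖ ^ 2 + 2 * @inner ℝ _ _ v d + ‖d‖ ^ 2 := norm_add_sq_real v d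
  have h3 : ‖v‖ + ‖v‖⁻¹ * @inner ℝ _ _ v d ≤ ‖v + d‖ := by
    rcases eq_or_ne v 0 with h0 | h0
    · simp [h0]
    · have hp : 0 < ‖v‖ := norm_pos_iff.2 h0
      have h4 : @inner ℝ _ _ v (v + d) ≤ ‖v‖ * ‖v + d‖ := real_inner_le_norm _ _
      rw [inner_add_right, real_inner_self_eq_norm_sq] at h4
      have h5 : (‖v‖ + ‖v‖⁻¹ * @inner ℝ _ _ v d) * ‖v‖ ≤ ‖v + d‖ * ‖v‖ := by
        have : (‖v‖ + ‖v‖⁻¹ * @inner ℝ _ _ v d) * ‖v‖ = ‖v‖ ^ 2 + @inner ℝ _ _ v d := by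
          field_simp
        rw [this]; linarith
      exact le_of_mul_le_mul_right h5 hp
  have h4 : ‖d‖ ^ 2 ≤ η ^ 2 := pow_le_pow_left₀ (norm_nonneg _) hη 2
  unfold penF penG
  rw [real_inner_smul_left]
  have h5 := mul_le_mul_of_nonneg_left h3 hm
  nlinarith

lemma scalar_step {ε α α' d m m' F F' Lam N ip Φ Φ' B A : ℝ} (hε : 0 < ε) (h1 : 1 ≤ α')
    (hA : α' ≤ A) (hd : 0 ≤ d) (hα : α' * (1 + 6 * d) ≤ α) (hm : 0 ≤ m) (hB : m ≤ B)
    (hm' : m' ≤ m + d) (hL : Lam ≤ d) (hL0 : 0 ≤ Lam) (hF : m ^ 2 / 2 ≤ F)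
    (hF' : F' ≤ F + ip + 3 * d ^ 2) (hN0 : 0 ≤ N) (hN : N ≤ α' / ε * (2 * m))
    (hΦ : Φ + α' / ε * ip - Lam * (1 + N) * m' ≤ Φ') :
    Φ - α / ε * (ε ^ 2 + F) - (1 + 2 * (A / ε) * B + 3 * (A / ε)) * d ^ 2 ≤
      Φ' - α' / ε * (ε ^ 2 + F') := by
  have hβ : 1 / ε ≤ α' / ε := by gcongr
  have hβA : α' / ε ≤ A / ε := by gcongr
  have hαβ : α' / ε * (1 + 6 * d) ≤ α / ε := by
    rw [div_mul_eq_mul_div]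
    gcongr
  generalize α' / ε = β at *
  generalize α / ε = γ at *
  generalize A / ε = δ at *
  have hβ0 : 0 < β := lt_of_lt_of_le (by positivity) hβ
  have hεβ : 1 ≤ β * ε := by rwa [div_le_iff₀ hε] at hβ
  have hF0 : 0 ≤ F := le_trans (by positivity) hF
  have e1 : β * (1 + 6 * d) * (ε ^ 2 + F) ≤ γ * (ε ^ 2 + F) := by gcongr
  have e2 : Lam * (1 + N) * m' ≤ d * (1 + β * (2 * m)) * (m + d) := by
    have : 0 ≤ m + d := by positivity
    calc Lam * (1 + N) * m' ≤ Lam * (1 + N) * (m + d) := by gcongr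
      _ ≤ _ := by gcongr
  have e3 : β * F' ≤ β * (F + ip + 3 * d ^ 2) := by gcongr
  have e4 : m + 2 * β * m ^ 2 ≤ 6 * β * (ε ^ 2 + F) := by
    have h2 : β * (m ^ 2 / 2) ≤ β * F := by gcongr
    have h3 : m ≤ β * (6 * ε ^ 2 + m ^ 2) := by
      have : m * (β * ε) ≤ β * (ε ^ 2 + m ^ 2) := by
        nlinarith [sq_nonneg (ε - m), mul_nonneg hβ0.le (sq_nonneg (ε - m)),
          mul_nonneg hβ0.le (mul_nonneg hε.le hm)]
      have h5 : m * 1 ≤ m * (β * ε) := by gcongr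
      nlinarith [mul_nonneg hβ0.le (sq_nonneg ε)]
    nlinarith
  have e5 : d * (m + 2 * β * m ^ 2) ≤ d * (6 * β * (ε ^ 2 + F)) := by gcongr
  have e6 : (1 + 2 * β * m + 3 * β) * d ^ 2 ≤ (1 + 2 * δ * B + 3 * δ) * d ^ 2 := by
    have : 0 ≤ δ := hβ0.le.trans hβA
    gcongr
  nlinarith

/-- One step of the construction. -/
lemma path_step {n : ℕ} {h T : ℝ} (hh : 0 ≤ h)
    {H₁ H₂ : ℝ → PathSp n h T → Euc n → ℝ} {c₁ c₂ : ℝ → ℝ}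
    (hH₁ : CondA H₁ c₁) (hH₂ : CondA H₂ c₂) {φ₁ φ₂ : ℝ → PathSp n h T → ℝ}
    (hL : PropL H₁ c₁ φ₁) (hU : PropU H₂ c₂ φ₂)
    {t : ℝ} (ht : t ∈ Set.Ico (0:ℝ) T) {x : PathSp n h T}
    (hcmp : ∀ y ∈ YSet t x c₁, ∃ E : Set ℝ, E ⊆ Set.Icc t T ∧
      volume E = ENNReal.ofReal (T - t) ∧
      ∀ τ ∈ E, ∀ s : Euc n, H₁ τ y s ≤ H₂ τ y s)
    {D : Set (PathSp n h T)} (hD₁ : YSet t x c₁ ⊆ D) (hD₂ : YSet t x c₂ ⊆ D)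
    {lam : ℝ → ℝ} (hlam : CondA3For H₂ D lam) {a b : ℝ} (ha : a ∈ Set.Ico t T)
    (hb : b ∈ Set.Ioc a T) {y₁ y₂ : PathSp n h T} (hy₁ : y₁ ∈ YSet t x c₁)
    (hy₂ : y₂ ∈ YSet t x c₂) (s : Euc n) :
    ∃ p ∈ YSet t x c₁, ∃ q ∈ YSet t x c₂, stopPath a p = stopPath a y₁ ∧
      stopPath a q = stopPath a y₂ ∧
      φ₁ a y₁ - φ₂ a y₂ + @inner ℝ _ _ s (evalP (p - q) b - evalP (p - q) a)
        - (∫ ξ in a..b, (Set.Icc 0 T).indicator lam ξ) * (1 + ‖s‖) * ‖stopPath b (p - q)‖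
        ≤ φ₁ b p - φ₂ b q := by
  have ha0 : a ∈ Set.Ico 0 T := ⟨ht.1.trans ha.1, ha.2⟩
  obtain ⟨p, hp, hpL⟩ := hL a ha0 y₁ s b hb
  obtain ⟨q, hq, hqU⟩ := hU a ha0 y₂ s b hb
  have hpY := YSet_concat hh ht hy₁ ha hp
  have hqY := YSet_concat hh ht hy₂ ha hq
  refine ⟨p.1, hpY, q.1, hqY, hp.1.1, hq.1.1, ?_⟩
  have hsub : Set.Icc a b ⊆ Set.Icc 0 T := Set.Icc_subset_Icc ha0.1 hb.2
  have hii : ∀ f : ℝ → ℝ, IntegrableOn f (Set.Icc 0 T) volume → IntervalIntegrable f volume a b := by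
    intro f hf
    rw [intervalIntegrable_iff_integrableOn_Icc_of_le hb.1.le]
    exact hf.mono_set hsub
  have i1 := hii _ (ham_integrable hH₁ p.1 s)
  have i2 := hii _ (ham_integrable hH₂ q.1 s)
  have hid : ∀ (r : PathSp n h T × (ℝ → Euc n)) (z : PathSp n h T) (c : ℝ → ℝ),
      r ∈ YPair a z c →
      IntervalIntegrable (fun ξ => @inner ℝ _ _ s (r.2 ξ)) volume a b ∧
      ∫ ξ in a..b, @inner ℝ _ _ s (r.2 ξ) = @inner ℝ _ _ s (evalP r.1 b - evalP r.1 a) := by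
    intro r z c hr
    have hr2 : IntervalIntegrable r.2 volume a b := by
      apply hr.1.2.1.mono_set
      rw [Set.uIcc_of_le ha.2.le, Set.uIcc_of_le hb.1.le]
      exact Set.Icc_subset_Icc_right hb.2
    refine ⟨⟨hr2.1.const_inner s, hr2.2.const_inner s⟩, ?_⟩
    rw [hr.1.2.2 b ⟨hb.1.le, hb.2⟩, add_sub_cancel_left]
    exact (innerSL ℝ s).intervalIntegral_comp_comm hr2
  obtain ⟨j1, k1⟩ := hid p _ _ hp
  obtain ⟨j2, k2⟩ := hid q _ _ hq
  rw [intervalIntegral.integral_sub j1 i1, k1] at hpL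
  rw [intervalIntegral.integral_sub j2 i2, k2] at hqU
  have hcomp : (∫ ξ in a..b, H₁ ξ p.1 s) ≤ (∫ ξ in a..b, H₂ ξ q.1 s) +
      (∫ ξ in a..b, (Set.Icc 0 T).indicator lam ξ) * (1 + ‖s‖) * ‖stopPath b (p.1 - q.1)‖ := by
    have i3 : IntervalIntegrable (fun ξ => (Set.Icc 0 T).indicator lam ξ *
        ((1 + ‖s‖) * ‖stopPath b (p.1 - q.1)‖)) volume a b :=
      ((ext_integrable hlam.1).1.mul_const _).intervalIntegrable
    rw [mul_assoc, ← intervalIntegral.integral_mul_const, ← intervalIntegral.integral_add i2 i3]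
    apply intervalIntegral.integral_mono_ae_restrict hb.1.le i1 (i2.add i3)
    obtain ⟨E, hE, hEv, hEc⟩ := hcmp p.1 hpY
    have htT : Set.Icc t T ⊆ Set.Icc 0 T := Set.Icc_subset_Icc_left ht.1
    have a1 := ae_le_of_full (fun ξ => H₁ ξ p.1 s) (fun ξ => H₂ ξ p.1 s)
      ((ham_aemeas hH₁.1 p.1 s).mono_measure (Measure.restrict_mono htT le_rfl))
      ((ham_aemeas hH₂.1 p.1 s).mono_measure (Measure.restrict_mono htT le_rfl))
      E hE hEv (fun τ hτ => hEc τ hτ s)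
    obtain ⟨E', hE', hEv', hEc'⟩ := hlam.2 p.1 (hD₁ hpY) q.1 (hD₂ hqY) s
    have hmeas : Measurable (fun ξ => ‖stopPath ξ (p.1 - q.1)‖) :=
      (norm_stopPath_mono (p.1 - q.1)).measurable
    have a2 := ae_le_of_full (fun ξ => |H₂ ξ p.1 s - H₂ ξ q.1 s|)
      (fun ξ => lam ξ * (1 + ‖s‖) * ‖stopPath ξ (p.1 - q.1)‖)
      ((ham_aemeas hH₂.1 p.1 s).sub (ham_aemeas hH₂.1 q.1 s)).abs
      ((hlam.1.1.aemeasurable.mul_const _).mul hmeas.aemeasurable)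
      E' hE' (by rw [hEv', sub_zero]) (fun τ hτ => by
        rw [stopPath_sub]; exact hEc' τ hτ)
    rw [ae_restrict_iff' measurableSet_Icc] at a1 a2
    rw [Filter.EventuallyLE, ae_restrict_iff' measurableSet_Icc]
    filter_upwards [a1, a2] with ξ h1 h2 h3
    have h0 := hsub h3
    have h1' := h1 ⟨ha.1.trans h3.1, h3.2.trans hb.2⟩
    have h2' := (le_abs_self _).trans (h2 h0)
    have h5 := norm_stopPath_mono (p.1 - q.1) h3.2
    simp only at h5
    have h6 : lam ξ * (1 + ‖s‖) * ‖stopPath ξ (p.1 - q.1)‖ ≤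
        lam ξ * (1 + ‖s‖) * ‖stopPath b (p.1 - q.1)‖ := by
      have := hlam.1.2 ξ h0
      gcongr
    rw [Set.indicator_of_mem h0, ← mul_assoc]
    linarith
  rw [evalP_sub, evalP_sub,
    show evalP p.1 b - evalP q.1 b - (evalP p.1 a - evalP q.1 a) =
      (evalP p.1 b - evalP p.1 a) - (evalP q.1 b - evalP q.1 a) by abel, inner_sub_right]
  linarith

lemma stopPath_mem_YSet {n : ℕ} {h T : ℝ} (hh : 0 ≤ h) {t : ℝ} (ht : t ∈ Set.Ico (0:ℝ) T)
    (x : PathSp n h T) {c : ℝ → ℝ} (hc : IntegNonneg T c) : stopPath t x ∈ YSet t x c := by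
  refine ⟨fun _ => 0, ⟨stopPath_stopPath le_rfl x, by simp, ?_⟩, ?_⟩
  · intro τ hτ
    have htm : t ∈ Set.Icc (-h) T := ⟨by linarith [ht.1], ht.2.le⟩
    have hτm : τ ∈ Set.Icc (-h) T := ⟨htm.1.trans hτ.1, hτ.2⟩
    simp only [intervalIntegral.integral_zero, add_zero]
    rw [evalP_of_mem _ htm, evalP_of_mem _ hτm, stopPath_apply, stopPath_apply,
      stopTime_ge htm hτ.1, stopTime_ge htm le_rfl]
  · rw [ae_restrict_iff' measurableSet_Icc]
    apply Filter.Eventually.of_forall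
    intro ξ hξ
    have := hc.2 ξ ⟨ht.1.trans hξ.1, hξ.2⟩
    simp only [norm_zero]
    positivity

/-- comparison principle: if `H₁ ≤ H₂` a.e. on `[t,T]` along
every `y(·) ∈ Y(t,x(·);c_{H₁}(·))`, then a lower solution for `H₁` does not
exceed an upper solution for `H₂` at `(t,x(·))`. -/
theorem stmt10 {n : ℕ} {h T : ℝ} (hT : 0 < T) (hh : 0 ≤ h)
    (H₁ H₂ : ℝ → PathSp n h T → Euc n → ℝ) (c₁ c₂ : ℝ → ℝ)
    (hH₁ : CondA H₁ c₁) (hH₂ : CondA H₂ c₂)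
    (σ : PathSp n h T → ℝ) (hσ : Continuous σ)
    (φ₁ φ₂ : ℝ → PathSp n h T → ℝ)
    (h₁ : LowerSol H₁ c₁ σ φ₁) (h₂ : UpperSol H₂ c₂ σ φ₂)
    (t : ℝ) (ht : t ∈ Set.Ico (0:ℝ) T) (x : PathSp n h T)
    (hcmp : ∀ y ∈ YSet t x c₁, ∃ E : Set ℝ, E ⊆ Set.Icc t T ∧
      volume E = ENNReal.ofReal (T - t) ∧
      ∀ τ ∈ E, ∀ s : Euc n, H₁ τ y s ≤ H₂ τ y s) :
    φ₁ t x ≤ φ₂ t x := by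
  obtain ⟨hNA₁, -, hσ₁, hL⟩ := h₁
  obtain ⟨hNA₂, -, hσ₂, hU⟩ := h₂
  have hc₁ : IntegNonneg T c₁ := hH₁.2.2.2.1.1
  have hc₂ : IntegNonneg T c₂ := hH₂.2.2.2.1.1
  obtain ⟨D₁, hD₁c, hD₁⟩ := YSet_compact hh ht x hc₁
  obtain ⟨D₂, hD₂c, hD₂⟩ := YSet_compact hh ht x hc₂
  have hDc : IsCompact (D₁ ∪ D₂) := hD₁c.union hD₂c
  have hDs₁ : YSet t x c₁ ⊆ D₁ ∪ D₂ := hD₁.trans subset_union_left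
  have hDs₂ : YSet t x c₂ ⊆ D₁ ∪ D₂ := hD₂.trans subset_union_right
  generalize D₁ ∪ D₂ = D at hDc hDs₁ hDs₂
  obtain ⟨lam, hlam⟩ := hH₂.2.2.1 D hDc
  obtain ⟨B₀, hB₀⟩ := hDc.isBounded.exists_norm_le
  have hx₁ := stopPath_mem_YSet hh ht x hc₁
  have hx₂ := stopPath_mem_YSet hh ht x hc₂
  have hB₀0 : 0 ≤ B₀ := (norm_nonneg _).trans (hB₀ _ (hDs₁ hx₁))
  have el := ext_integrable hlam.1
  have e₁ := ext_integrable hc₁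
  have e₂ := ext_integrable hc₂
  -- the scale function
  obtain ⟨g, hg⟩ : ∃ g : ℝ → ℝ, g = fun ξ => (Set.Icc 0 T).indicator lam ξ +
      ((Set.Icc 0 T).indicator c₁ ξ * (1 + B₀) + (Set.Icc 0 T).indicator c₂ ξ * (1 + B₀)) :=
    ⟨_, rfl⟩
  have hgi : Integrable g := by
    rw [hg]
    exact el.1.add ((e₁.1.mul_const _).add (e₂.1.mul_const _))
  have hg0 : ∀ ξ, 0 ≤ g ξ := by
    intro ξ
    rw [hg]
    have := el.2 ξ
    have := e₁.2 ξ
    have := e₂.2 ξ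
    positivity
  have hgsplit : ∀ u v, ∫ ξ in u..v, g ξ = (∫ ξ in u..v, (Set.Icc 0 T).indicator lam ξ) +
      ((∫ ξ in u..v, (Set.Icc 0 T).indicator c₁ ξ) * (1 + B₀) +
        (∫ ξ in u..v, (Set.Icc 0 T).indicator c₂ ξ) * (1 + B₀)) := by
    intro u v
    have k1 : IntervalIntegrable (fun ξ => (Set.Icc 0 T).indicator c₁ ξ * (1 + B₀)) volume u v :=
      (e₁.1.mul_const _).intervalIntegrable
    have k2 : IntervalIntegrable (fun ξ => (Set.Icc 0 T).indicator c₂ ξ * (1 + B₀)) volume u v :=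
      (e₂.1.mul_const _).intervalIntegrable
    have k0 : IntervalIntegrable (fun ξ => (Set.Icc 0 T).indicator lam ξ) volume u v :=
      el.1.intervalIntegrable
    have k12 : IntervalIntegrable (fun ξ => (Set.Icc 0 T).indicator c₁ ξ * (1 + B₀) +
        (Set.Icc 0 T).indicator c₂ ξ * (1 + B₀)) volume u v := k1.add k2
    rw [hg, intervalIntegral.integral_add k0 k12, intervalIntegral.integral_add k1 k2,
      intervalIntegral.integral_mul_const, intervalIntegral.integral_mul_const]
  obtain ⟨G, hG⟩ : ∃ G : ℝ → ℝ, G = fun τ => ∫ ξ in t..τ, g ξ := ⟨_, rfl⟩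
  have hGc : Continuous G := hG ▸ continuous_prim hgi t
  have hGsub : ∀ u v, G v - G u = ∫ ξ in u..v, g ξ := by
    intro u v
    rw [hG]
    exact prim_sub hgi t u v
  have hGmono : Monotone G := by
    intro u v huv
    have := hGsub u v
    have : 0 ≤ ∫ ξ in u..v, g ξ := intervalIntegral.integral_nonneg huv (fun w _ => hg0 w)
    linarith
  have hGt : G t = 0 := by rw [hG]; simp
  have hGT : 0 ≤ G T := hGt ▸ hGmono ht.2.le
  have hint0 : ∀ f : ℝ → ℝ, (∀ ξ, 0 ≤ f ξ) → ∀ u v, u ≤ v → 0 ≤ ∫ ξ in u..v, f ξ :=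
    fun f hf u v huv => intervalIntegral.integral_nonneg huv (fun w _ => hf w)
  -- increments of the difference
  have hinc : ∀ p ∈ YSet t x c₁, ∀ q ∈ YSet t x c₂, ∀ u v, t ≤ u → u ≤ v → v ≤ T →
      ‖evalP (p - q) v - evalP (p - q) u‖ ≤ G v - G u := by
    rintro p hp q hq u v hu huv hv
    have hpB := hB₀ p (hDs₁ hp)
    have hqB := hB₀ q (hDs₂ hq)
    obtain ⟨p', hp⟩ := hp
    obtain ⟨q', hq⟩ := hq
    have i1 := YPair_inc hh ht hc₁ hp hu huv hv
    have i2 := YPair_inc hh ht hc₂ hq hu huv hv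
    simp only at i1 i2
    rw [hGsub, hgsplit]
    have z0 := hint0 _ el.2 u v huv
    have z1 := hint0 _ e₁.2 u v huv
    have z2 := hint0 _ e₂.2 u v huv
    have n1 := (norm_stopPath_le v p).trans hpB
    have n2 := (norm_stopPath_le v q).trans hqB
    have j1 := mul_le_mul_of_nonneg_left (add_le_add_right n1 1) z1
    have j2 := mul_le_mul_of_nonneg_left (add_le_add_right n2 1) z2
    rw [evalP_sub, evalP_sub, show evalP p v - evalP q v - (evalP p u - evalP q u) =
      (evalP p v - evalP p u) - (evalP q v - evalP q u) by abel]
    have := norm_sub_le (evalP p v - evalP p u) (evalP q v - evalP q u)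
    linarith
  obtain ⟨α, hα⟩ : ∃ α : ℝ → ℝ, α = fun τ => Real.exp (6 * (G T - G τ)) := ⟨_, rfl⟩
  -- the main construction
  have key : ∀ ε > 0, ∃ p ∈ YSet t x c₁, ∃ q ∈ YSet t x c₂,
      φ₁ t x - φ₂ t x + ‖p - q‖ ^ 2 / (2 * ε) ≤ σ p - σ q + (α t + 1) * ε := by
    intro ε hε
    obtain ⟨C, hC⟩ : ∃ C, C = 1 + 2 * (α t / ε) * (2 * B₀) + 3 * (α t / ε) := ⟨_, rfl⟩
    have hαt0 : 0 < α t := by rw [hα]; exact Real.exp_pos _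
    have hC0 : 0 < C := by rw [hC]; positivity
    obtain ⟨δ, hδ⟩ : ∃ δ, δ = ε / (C * G T + 1) := ⟨_, rfl⟩
    have hδ0 : 0 < δ := by rw [hδ]; positivity
    have hδε : C * δ * G T ≤ ε := by
      rw [hδ, show C * (ε / (C * G T + 1)) * G T = ε * (C * G T) / (C * G T + 1) by ring,
        div_le_iff₀ (by positivity)]
      nlinarith
    obtain ⟨N, τ, h0, hN, hmono, hstep⟩ := exists_partition ht.2 G hGc hδ0
    have ind : ∀ i ≤ N, ∃ p ∈ YSet t x c₁, ∃ q ∈ YSet t x c₂,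
        φ₁ t x - φ₂ t x - α t * ε - C * δ * G (τ i) ≤
        φ₁ (τ i) p - φ₂ (τ i) q - α (τ i) / ε *
          (ε ^ 2 + penF ‖stopPath (τ i) (p - q)‖ (evalP (p - q) (τ i))) := by
      intro i
      induction i with
      | zero =>
        intro _
        refine ⟨_, hx₁, _, hx₂, ?_⟩
        have htI : t ∈ Set.Icc (0:ℝ) T := ⟨ht.1, ht.2.le⟩
        have z : evalP (0 : PathSp n h T) t = 0 := by
          unfold evalP
          split_ifs <;> simp
        have z' : stopPath t (0 : PathSp n h T) = 0 := by
          ext1 r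
          simp [stopPath_apply]
        rw [h0, ← hNA₁ t htI, ← hNA₂ t htI, sub_self, z, z', hGt]
        simp only [penF, norm_zero]
        have : α t / ε * (ε ^ 2 + ((0 - 0) ^ 2 + 0 ^ 2)) = α t * ε := by field_simp; ring
        linarith
      | succ i ih =>
        intro hi
        obtain ⟨y₁, hy₁, y₂, hy₂, hle⟩ := ih (by omega)
        have hta : t ≤ τ i := h0 ▸ hmono.monotone (Nat.zero_le i)
        have hab : τ i < τ (i + 1) := hmono (Nat.lt_succ_self i)
        have hbT : τ (i + 1) ≤ T := hN ▸ hmono.monotone hi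
        have hst := hstep i (by omega)
        generalize τ i = a at *
        generalize τ (i + 1) = b at *
        have haT : a < T := lt_of_lt_of_le hab hbT
        have ham : a ∈ Set.Icc (-h) T := ⟨by linarith [ht.1], haT.le⟩
        have hbm : b ∈ Set.Icc (-h) T := ⟨by linarith [ht.1], hbT⟩
        obtain ⟨p, hp, q, hq, hpa, hqa, hpq⟩ := path_step hh hH₁ hH₂ hL hU ht hcmp hDs₁ hDs₂
          hlam ⟨hta, haT⟩ ⟨hab, hbT⟩ hy₁ hy₂
          ((α b / ε) • penG ‖stopPath a (y₁ - y₂)‖ (evalP (y₁ - y₂) a))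
        have hwa : stopPath a (p - q) = stopPath a (y₁ - y₂) := by
          rw [stopPath_sub, stopPath_sub, hpa, hqa]
        have hva : evalP (p - q) a = evalP (y₁ - y₂) a := by
          rw [← evalP_stopPath _ ham le_rfl, hwa, evalP_stopPath _ ham le_rfl]
        refine ⟨p, hp, q, hq, ?_⟩
        rw [← hwa, ← hva] at hle hpq
        have hd0 : 0 ≤ G b - G a := sub_nonneg.2 (hGmono hab.le)
        have hdδ : G b - G a ≤ δ := (le_abs_self _).trans hst
        have hv : ‖evalP (p - q) a‖ ≤ ‖stopPath a (p - q)‖ := norm_evalP_le _ ham le_rfl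
        have hv' : ‖evalP (p - q) b‖ ≤ ‖stopPath b (p - q)‖ := norm_evalP_le _ hbm le_rfl
        have hmm := norm_stopPath_mono (p - q) hab.le
        simp only at hmm
        have hα1 : 1 ≤ α b := by
          rw [hα]
          apply Real.one_le_exp
          have := hGmono hbT
          linarith
        have hαA : α b ≤ α t := by
          rw [hα]
          apply Real.exp_le_exp.2
          have := hGmono (hta.trans hab.le)
          linarith
        have hαstep : α b * (1 + 6 * (G b - G a)) ≤ α a := by
          rw [hα]
          simp only
          rw [show 6 * (G T - G a) = 6 * (G T - G b) + 6 * (G b - G a) by ring, Real.exp_add]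
          have := Real.add_one_le_exp (6 * (G b - G a))
          have := Real.exp_pos (6 * (G T - G b))
          gcongr
          linarith
        have hmB : ‖stopPath a (p - q)‖ ≤ 2 * B₀ := by
          have h1 := norm_stopPath_le a (p - q)
          have h2 := norm_sub_le p q
          have h3 := hB₀ p (hDs₁ hp)
          have h4 := hB₀ q (hDs₂ hq)
          linarith
        have hm'1 : ‖stopPath b (p - q)‖ ≤ ‖stopPath a (p - q)‖ + (G b - G a) := by
          apply norm_stopPath_le_of _ ham.1 hab.le hbT (by linarith)
          intro r hr
          have h1 := hinc p hp q hq a r hta hr.1 (hr.2.trans hbT)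
          have h2 := hGmono hr.2
          have h3 := norm_add_le (evalP (p - q) a) (evalP (p - q) r - evalP (p - q) a)
          rw [add_sub_cancel] at h3
          linarith
        have hm'2 : ‖stopPath b (p - q)‖ ≤
            max ‖stopPath a (p - q)‖ (‖evalP (p - q) b‖ + (G b - G a)) := by
          apply norm_stopPath_le_of _ ham.1 hab.le hbT (le_max_left _ _)
          intro r hr
          apply le_max_of_le_right
          have h1 := hinc p hp q hq r b (hta.trans hr.1) hr.2 hbT
          have h2 := hGmono hr.1
          have h3 := norm_sub_le (evalP (p - q) b) (evalP (p - q) b - evalP (p - q) r)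
          rw [sub_sub_cancel] at h3
          linarith
        have hF' := penF_step (norm_nonneg _) hv' hmm (hinc p hp q hq a b hta hab.le hbT) hm'2
        have hLam : (∫ ξ in a..b, (Set.Icc 0 T).indicator lam ξ) ≤ G b - G a := by
          rw [hGsub, hgsplit]
          have z1 := hint0 _ e₁.2 a b hab.le
          have z2 := hint0 _ e₂.2 a b hab.le
          have : 0 ≤ (∫ ξ in a..b, (Set.Icc 0 T).indicator c₁ ξ) * (1 + B₀) +
            (∫ ξ in a..b, (Set.Icc 0 T).indicator c₂ ξ) * (1 + B₀) := by positivity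
          linarith
        have hβ0 : 0 ≤ α b / ε := div_nonneg (by linarith) hε.le
        have hNn : ‖(α b / ε) • penG ‖stopPath a (p - q)‖ (evalP (p - q) a)‖ ≤
            α b / ε * (2 * ‖stopPath a (p - q)‖) := by
          rw [norm_smul, Real.norm_eq_abs, abs_of_nonneg hβ0]
          exact mul_le_mul_of_nonneg_left (penG_norm hv) hβ0
        rw [real_inner_smul_left] at hpq
        have hfin := scalar_step hε hα1 hαA hd0 hαstep (norm_nonneg _) hmB hm'1 hLam
          (hint0 _ el.2 a b hab.le) (penF_lower _ (evalP (p - q) a)) hF' (norm_nonneg _) hNn hpq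
        rw [← hC] at hfin
        have hCd : C * (G b - G a) ^ 2 ≤ C * δ * (G b - G a) := by
          rw [pow_two, mul_assoc]
          gcongr
        have : C * δ * G b = C * δ * G a + C * δ * (G b - G a) := by ring
        linarith
    obtain ⟨p, hp, q, hq, hpq⟩ := ind N le_rfl
    refine ⟨p, hp, q, hq, ?_⟩
    rw [hN, stopPath_T] at hpq
    have hαT : α T = 1 := by rw [hα]; simp
    rw [hαT] at hpq
    have h1 := penF_lower ‖p - q‖ (evalP (p - q) T)
    have h2 : 1 / ε * (‖p - q‖ ^ 2 / 2) ≤ 1 / ε * (ε ^ 2 + penF ‖p - q‖ (evalP (p - q) T)) := by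
      have := sq_nonneg ε
      gcongr
      linarith
    have h3 : 1 / ε * (‖p - q‖ ^ 2 / 2) = ‖p - q‖ ^ 2 / (2 * ε) := by
      field_simp
    have h4 := hσ₁ p
    have h5 := hσ₂ q
    linarith
  -- conclusion
  by_contra hcon
  push Not at hcon
  obtain ⟨Δ, hΔ⟩ : ∃ Δ, Δ = φ₁ t x - φ₂ t x := ⟨_, rfl⟩
  have hΔ0 : 0 < Δ := by rw [hΔ]; linarith
  have hu := hDc.uniformContinuousOn_of_continuous hσ.continuousOn
  rw [Metric.uniformContinuousOn_iff] at hu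
  obtain ⟨ρ, hρ, hu⟩ := hu (Δ / 2) (by linarith)
  obtain ⟨S, hS⟩ := hDc.exists_bound_of_continuousOn hσ.continuousOn
  have hS0 : 0 ≤ S := (norm_nonneg _).trans (hS _ (hDs₁ hx₁))
  have hαt0 : 0 < α t := by rw [hα]; exact Real.exp_pos _
  obtain ⟨ε, hε⟩ : ∃ ε, ε = min (Δ / (2 * (α t + 1))) (ρ ^ 2 / (4 * S + 1)) := ⟨_, rfl⟩
  have hε0 : 0 < ε := by rw [hε]; positivity
  have hε1 : (α t + 1) * ε ≤ Δ / 2 := by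
    have : ε ≤ Δ / (2 * (α t + 1)) := hε ▸ min_le_left _ _
    rw [le_div_iff₀ (by positivity)] at this
    linarith
  have hε2 : 4 * S * ε < ρ ^ 2 := by
    have : ε ≤ ρ ^ 2 / (4 * S + 1) := hε ▸ min_le_right _ _
    rw [le_div_iff₀ (by positivity)] at this
    linarith
  obtain ⟨p, hp, q, hq, hpq⟩ := key ε hε0
  rw [← hΔ] at hpq
  have s1 := abs_le.1 (hS p (hDs₁ hp))
  have s2 := abs_le.1 (hS q (hDs₂ hq))
  have hm : ‖p - q‖ ^ 2 / (2 * ε) ≤ 2 * S := by linarith [s1.2, s2.1]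
  rw [div_le_iff₀ (by positivity)] at hm
  have hlt : ‖p - q‖ < ρ := by
    apply lt_of_pow_lt_pow_left₀ 2 hρ.le
    linarith
  have h7 := hu p (hDs₁ hp) q (hDs₂ hq) (by rwa [dist_eq_norm])
  rw [Real.dist_eq] at h7
  have h8 := (le_abs_self _).trans_lt h7
  have h9 : 0 ≤ ‖p - q‖ ^ 2 / (2 * ε) := by positivity
  linarith

end
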